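/- arXiv:1907.00711 — 6 statements merged into one kernel-verified Lean document; each statement's English description precedes it below -/
import Mathlib

section
/- For any τ in the upper half-plane (Im τ > 0) and all complex numbers x and y, the Jacobi theta functions satisfy the identity θ₂(x+y|2τ)·θ₃(x−y|2τ)·(θ₁(x|τ)·θ₂(y|τ) + θ₁(y|τ)·θ₂(x|τ)) = θ₁(x+y|2τ)·θ₄(x−y|2τ)·(θ₂(x|τ)·θ₂(y|τ) − θ₁(x|τ)·θ₁(y|τ)). -/
open Complex

/-- Jacobi theta function θ₁(z|τ) with nome q = exp(πiτ). -/
noncomputable def theta1 (z τ : ℂ) : ℂ :=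
  -I * exp ((Real.pi : ℂ) * I * τ / 4) *
    ∑' k : ℤ, (-1 : ℂ) ^ k * exp ((Real.pi : ℂ) * I * τ * ((k : ℂ) * ((k : ℂ) + 1))) *
      exp ((2 * (k : ℂ) + 1) * z * I)

/-- Jacobi theta function θ₂(z|τ) with nome q = exp(πiτ). -/
noncomputable def theta2 (z τ : ℂ) : ℂ :=
  exp ((Real.pi : ℂ) * I * τ / 4) *
    ∑' k : ℤ, exp ((Real.pi : ℂ) * I * τ * ((k : ℂ) * ((k : ℂ) + 1))) *
      exp ((2 * (k : ℂ) + 1) * z * I)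

/-- Jacobi theta function θ₃(z|τ) with nome q = exp(πiτ). -/
noncomputable def theta3 (z τ : ℂ) : ℂ :=
  ∑' k : ℤ, exp ((Real.pi : ℂ) * I * τ * ((k : ℂ) ^ 2)) * exp (2 * (k : ℂ) * z * I)

/-- Jacobi theta function θ₄(z|τ) with nome q = exp(πiτ). -/
noncomputable def theta4 (z τ : ℂ) : ℂ :=
  ∑' k : ℤ, (-1 : ℂ) ^ k * exp ((Real.pi : ℂ) * I * τ * ((k : ℂ) ^ 2)) * exp (2 * (k : ℂ) * z * I)

lemma summable_norm_theta2_term (z : ℂ) {τ : ℂ} (hτ : 0 < τ.im) :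
    Summable fun k : ℤ ↦ ‖exp ((Real.pi : ℂ) * I * τ * ((k : ℂ) * ((k : ℂ) + 1))) *
      exp ((2 * (k : ℂ) + 1) * z * I)‖ := by
  refine Summable.norm ((((summable_jacobiTheta₂_term_iff (z / Real.pi + τ / 2) τ).2 hτ).mul_left
    (exp (z * I))).congr fun k ↦ ?_)
  have hpi : (Real.pi : ℂ) ≠ 0 := ofReal_ne_zero.2 Real.pi_ne_zero
  rw [jacobiTheta₂_term, ← exp_add, ← exp_add]
  congr 1
  field_simp
  ring

lemma summable_norm_theta3_term (z : ℂ) {τ : ℂ} (hτ : 0 < τ.im) :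
    Summable fun k : ℤ ↦ ‖exp ((Real.pi : ℂ) * I * τ * ((k : ℂ) ^ 2)) *
      exp (2 * (k : ℂ) * z * I)‖ := by
  refine Summable.norm (((summable_jacobiTheta₂_term_iff (z / Real.pi) τ).2 hτ).congr fun k ↦ ?_)
  have hpi : (Real.pi : ℂ) ≠ 0 := ofReal_ne_zero.2 Real.pi_ne_zero
  rw [jacobiTheta₂_term, ← exp_add]
  congr 1
  field_simp
  ring

lemma summable_norm_theta1_term (z : ℂ) {τ : ℂ} (hτ : 0 < τ.im) :
    Summable fun k : ℤ ↦ ‖(-1 : ℂ) ^ k *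
      exp ((Real.pi : ℂ) * I * τ * ((k : ℂ) * ((k : ℂ) + 1))) *
      exp ((2 * (k : ℂ) + 1) * z * I)‖ := by
  simpa [norm_mul, norm_zpow] using summable_norm_theta2_term z hτ

lemma summable_norm_theta4_term (z : ℂ) {τ : ℂ} (hτ : 0 < τ.im) :
    Summable fun k : ℤ ↦ ‖(-1 : ℂ) ^ k * exp ((Real.pi : ℂ) * I * τ * ((k : ℂ) ^ 2)) *
      exp (2 * (k : ℂ) * z * I)‖ := by
  simpa [norm_mul, norm_zpow] using summable_norm_theta3_term z hτ

/-- If `f₁ m * g₁ n + f₂ m * g₂ n` is supported on the pairs `(m, n)` with `m + n` even, and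
factorises in the coordinates `m = k + l`, `n = k - l`, then so does the double sum. -/
lemma tsum_mul_tsum_add_eq_of_even {f₁ g₁ f₂ g₂ p r : ℤ → ℂ}
    (hf₁ : Summable (‖f₁ ·‖)) (hg₁ : Summable (‖g₁ ·‖))
    (hf₂ : Summable (‖f₂ ·‖)) (hg₂ : Summable (‖g₂ ·‖))
    (hp : Summable (‖p ·‖)) (hr : Summable (‖r ·‖)) (c : ℂ)
    (hodd : ∀ m n, Odd (m + n) → f₁ m * g₁ n + f₂ m * g₂ n = 0)
    (heven : ∀ k l, f₁ (k + l) * g₁ (k - l) + f₂ (k + l) * g₂ (k - l) = c * (p k * r l)) :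
    (∑' k, f₁ k) * (∑' k, g₁ k) + (∑' k, f₂ k) * (∑' k, g₂ k) =
      c * ((∑' k, p k) * ∑' k, r k) := by
  rw [tsum_mul_tsum_of_summable_norm hf₁ hg₁, tsum_mul_tsum_of_summable_norm hf₂ hg₂,
    tsum_mul_tsum_of_summable_norm hp hr,
    ← (summable_mul_of_summable_norm hf₁ hg₁).tsum_add (summable_mul_of_summable_norm hf₂ hg₂),
    ← tsum_mul_left]
  have hinj : Function.Injective fun a : ℤ × ℤ ↦ (a.1 + a.2, a.1 - a.2) := by
    rintro ⟨a, b⟩ ⟨a', b'⟩ h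
    simp only [Prod.mk.injEq] at h ⊢
    omega
  rw [← hinj.tsum_eq]
  · exact tsum_congr fun a ↦ heven a.1 a.2
  · rintro ⟨m, n⟩ hmn
    rcases Int.even_or_odd (m + n) with ⟨k, hk⟩ | h
    · refine ⟨(k, m - k), ?_⟩
      simp only [Prod.mk.injEq]
      omega
    · exact absurd (hodd m n h) hmn

lemma exp_add_mul_exp_sub_eq (τ x y k l : ℂ) :
    exp ((Real.pi : ℂ) * I * τ * ((k + l) * (k + l + 1))) * exp ((2 * (k + l) + 1) * x * I) *
      (exp ((Real.pi : ℂ) * I * τ * ((k - l) * (k - l + 1))) *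
        exp ((2 * (k - l) + 1) * y * I)) =
    exp ((Real.pi : ℂ) * I * (2 * τ) * (k * (k + 1))) * exp ((2 * k + 1) * (x + y) * I) *
      (exp ((Real.pi : ℂ) * I * (2 * τ) * l ^ 2) * exp (2 * l * (x - y) * I)) := by
  simp only [← exp_add]
  congr 1
  ring

lemma neg_one_zpow_sub_eq_add (k l : ℤ) : (-1 : ℂ) ^ (k - l) = (-1 : ℂ) ^ (k + l) := by
  rw [show k + l = k - l + 2 * l by ring, zpow_add₀ (by norm_num), zpow_mul]
  norm_num

lemma exp_pi_I_two_mul_div_four (τ : ℂ) :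
    exp ((Real.pi : ℂ) * I * (2 * τ) / 4) = exp ((Real.pi : ℂ) * I * τ / 4) ^ 2 := by
  rw [← exp_nat_mul]
  congr 1
  push_cast
  ring

lemma im_two_mul_pos {τ : ℂ} (hτ : 0 < τ.im) : 0 < (2 * τ).im := by
  simpa using hτ

theorem theta2_mul_theta2_sub_theta1_mul_theta1 {τ : ℂ} (hτ : 0 < τ.im) (x y : ℂ) :
    theta2 x τ * theta2 y τ - theta1 x τ * theta1 y τ =
      2 * (theta2 (x + y) (2 * τ) * theta3 (x - y) (2 * τ)) := by
  have hτ' := im_two_mul_pos hτ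
  have key := tsum_mul_tsum_add_eq_of_even (summable_norm_theta2_term x hτ)
    (summable_norm_theta2_term y hτ) (summable_norm_theta1_term x hτ)
    (summable_norm_theta1_term y hτ) (summable_norm_theta2_term (x + y) hτ')
    (summable_norm_theta3_term (x - y) hτ') 2
    (fun m n h ↦ by
      have hs : (-1 : ℂ) ^ m * (-1) ^ n = -1 := by
        rw [← zpow_add₀ (by norm_num), h.neg_one_zpow]
      linear_combination (exp (Real.pi * I * τ * (m * (m + 1))) * exp ((2 * m + 1) * x * I) *
        (exp (Real.pi * I * τ * (n * (n + 1))) * exp ((2 * n + 1) * y * I))) * hs)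
    (fun k l ↦ by
      have hs : (-1 : ℂ) ^ (k + l) * (-1) ^ (k + l) = 1 := by
        rw [← mul_zpow]
        norm_num
      have he := exp_add_mul_exp_sub_eq τ x y k l
      rw [neg_one_zpow_sub_eq_add]
      push_cast
      linear_combination (1 + (-1 : ℂ) ^ (k + l) * (-1) ^ (k + l)) * he +
        (exp (Real.pi * I * (2 * τ) * (k * (k + 1))) * exp ((2 * k + 1) * (x + y) * I) *
        (exp (Real.pi * I * (2 * τ) * l ^ 2) * exp (2 * l * (x - y) * I))) * hs)
  simp only [theta1, theta2, theta3, exp_pi_I_two_mul_div_four]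
  linear_combination (exp (Real.pi * I * τ / 4) ^ 2) * key -
    (exp (Real.pi * I * τ / 4) ^ 2) * (∑' k : ℤ, (-1 : ℂ) ^ k *
      exp (Real.pi * I * τ * (k * (k + 1))) * exp ((2 * k + 1) * x * I)) *
    (∑' k : ℤ, (-1 : ℂ) ^ k *
      exp (Real.pi * I * τ * (k * (k + 1))) * exp ((2 * k + 1) * y * I)) * I_sq

theorem theta1_mul_theta2_add_theta1_mul_theta2 {τ : ℂ} (hτ : 0 < τ.im) (x y : ℂ) :
    theta1 x τ * theta2 y τ + theta1 y τ * theta2 x τ =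
      2 * (theta1 (x + y) (2 * τ) * theta4 (x - y) (2 * τ)) := by
  have hτ' := im_two_mul_pos hτ
  have key := tsum_mul_tsum_add_eq_of_even (summable_norm_theta1_term x hτ)
    (summable_norm_theta2_term y hτ) (summable_norm_theta2_term x hτ)
    (summable_norm_theta1_term y hτ) (summable_norm_theta1_term (x + y) hτ')
    (summable_norm_theta4_term (x - y) hτ') 2
    (fun m n h ↦ by
      have hs : (-1 : ℂ) ^ m + (-1) ^ n = 0 := by
        rcases Int.even_or_odd n with hn | hn
        · rw [hn.neg_one_zpow, (Int.odd_add.1 h |>.2 hn).neg_one_zpow]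
          norm_num
        · rw [hn.neg_one_zpow, (Int.odd_add'.1 h |>.1 hn).neg_one_zpow]
          norm_num
      linear_combination (exp (Real.pi * I * τ * (m * (m + 1))) * exp ((2 * m + 1) * x * I) *
        (exp (Real.pi * I * τ * (n * (n + 1))) * exp ((2 * n + 1) * y * I))) * hs)
    (fun k l ↦ by
      have he := exp_add_mul_exp_sub_eq τ x y k l
      rw [neg_one_zpow_sub_eq_add, zpow_add₀ (by norm_num)]
      push_cast
      linear_combination 2 * (-1 : ℂ) ^ k * (-1) ^ l * he)
  simp only [theta1, theta2, theta4, exp_pi_I_two_mul_div_four]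
  linear_combination (-I * exp (Real.pi * I * τ / 4) ^ 2) * key

theorem theta_identity (τ : ℂ) (hτ : 0 < τ.im) (x y : ℂ) :
    theta2 (x + y) (2 * τ) * theta3 (x - y) (2 * τ) *
      (theta1 x τ * theta2 y τ + theta1 y τ * theta2 x τ) =
    theta1 (x + y) (2 * τ) * theta4 (x - y) (2 * τ) *
      (theta2 x τ * theta2 y τ - theta1 x τ * theta1 y τ) := by
  rw [theta2_mul_theta2_sub_theta1_mul_theta1 hτ, theta1_mul_theta2_add_theta1_mul_theta2 hτ]
  ring
end

section
/- For any τ in the upper half-plane and every complex number z, one has 2·θ₂(z|2τ)·θ₃(z|2τ) = ϑ₂(τ)·θ₂(z|τ), where ϑ₂(τ) = θ₂(0|τ). -/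
open Complex

theorem summable_theta2_term {τ : ℂ} (hτ : 0 < τ.im) (z : ℂ) :
    Summable fun k : ℤ ↦ exp ((Real.pi : ℂ) * I * τ * ((k : ℂ) * ((k : ℂ) + 1))) *
      exp ((2 * (k : ℂ) + 1) * z * I) := by
  refine (((summable_jacobiTheta₂_term_iff (z / Real.pi + τ / 2) τ).2 hτ).mul_left
    (exp (z * I))).congr fun k ↦ ?_
  have hπ : (Real.pi : ℂ) ≠ 0 := ofReal_ne_zero.2 Real.pi_ne_zero
  simp only [jacobiTheta₂_term, ← exp_add]
  congr 1
  field_simp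
  ring

theorem summable_theta3_term {τ : ℂ} (hτ : 0 < τ.im) (z : ℂ) :
    Summable fun k : ℤ ↦ exp ((Real.pi : ℂ) * I * τ * ((k : ℂ) ^ 2)) *
      exp (2 * (k : ℂ) * z * I) := by
  refine ((summable_jacobiTheta₂_term_iff (z / Real.pi) τ).2 hτ).congr fun k ↦ ?_
  have hπ : (Real.pi : ℂ) ≠ 0 := ofReal_ne_zero.2 Real.pi_ne_zero
  simp only [jacobiTheta₂_term, ← exp_add]
  congr 1
  field_simp
  ring

theorem theta2_eq_tsum (z τ : ℂ) :
    theta2 z τ = ∑' k : ℤ, exp ((Real.pi : ℂ) * I * τ / 4) *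
      (exp ((Real.pi : ℂ) * I * τ * ((k : ℂ) * ((k : ℂ) + 1))) *
        exp ((2 * (k : ℂ) + 1) * z * I)) :=
  tsum_mul_left.symm

/-- The lattice `ℤ × ℤ` split into the pairs with even and with odd difference, each class being
parametrized by `ℤ × ℤ`. -/
def latticeParityMap : (ℤ × ℤ) ⊕ (ℤ × ℤ) → ℤ × ℤ :=
  Sum.elim (fun p ↦ (p.1 - p.2, p.1 + p.2)) (fun p ↦ (p.2 - p.1 - 1, p.1 + p.2))

theorem latticeParityMap_bijective : Function.Bijective latticeParityMap := by
  constructor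
  · rintro (⟨a, b⟩ | ⟨a, b⟩) (⟨c, d⟩ | ⟨c, d⟩) h <;>
      simp only [latticeParityMap, Sum.elim_inl, Sum.elim_inr, Prod.mk.injEq, Sum.inl.injEq,
        Sum.inr.injEq, reduceCtorEq] at h ⊢ <;> omega
  · rintro ⟨b, a⟩
    rcases Int.even_or_odd' (a - b) with ⟨n, hn | hn⟩
    · refine ⟨.inl (a - n, n), ?_⟩
      simp only [latticeParityMap, Sum.elim_inl, Prod.mk.injEq]
      omega
    · refine ⟨.inr (n, a - n), ?_⟩
      simp only [latticeParityMap, Sum.elim_inr, Prod.mk.injEq]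
      omega

theorem theta2_theta3_duplication (τ : ℂ) (hτ : 0 < τ.im) (z : ℂ) :
    2 * theta2 z (2 * τ) * theta3 z (2 * τ) = theta2 0 τ * theta2 z τ := by
  have h2τ : 0 < (2 * τ).im := by simpa using hτ
  let e := Equiv.ofBijective latticeParityMap latticeParityMap_bijective
  have hleft := ((summable_theta2_term h2τ z).mul_left
    (exp ((Real.pi : ℂ) * I * (2 * τ) / 4))).norm
  have hright := (summable_theta3_term h2τ z).norm
  have hzero := ((summable_theta2_term hτ 0).mul_left (exp ((Real.pi : ℂ) * I * τ / 4))).norm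
  have hz := ((summable_theta2_term hτ z).mul_left (exp ((Real.pi : ℂ) * I * τ / 4))).norm
  have hsum := (summable_mul_of_summable_norm hleft hright).hasSum
  rw [mul_assoc, theta2_eq_tsum, theta2_eq_tsum, theta2_eq_tsum, theta3,
    tsum_mul_tsum_of_summable_norm hleft hright,
    tsum_mul_tsum_of_summable_norm hzero hz, two_mul]
  refine Eq.symm (HasSum.tsum_eq (e.hasSum_iff.1 ?_))
  apply HasSum.sum
  all_goals
    convert hsum using 2 with p
    simp only [e, latticeParityMap, Function.comp_apply, Equiv.ofBijective_apply, Sum.elim_inl,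
      Sum.elim_inr, ← exp_add]
    congr 1
    push_cast
    ring
end

section
/- For any τ in the upper half-plane and every complex number z, one has 2·θ₁(z|2τ)·θ₄(z|2τ) = ϑ₂(τ)·θ₁(z|τ), where ϑ₂(τ) = θ₂(0|τ). -/
open Complex

theorem summable_norm_theta_odd_term (z : ℂ) {τ : ℂ} (hτ : 0 < τ.im) :
    Summable fun k : ℤ => ‖exp ((Real.pi : ℂ) * I * τ * ((k : ℂ) * ((k : ℂ) + 1))) *
      exp ((2 * (k : ℂ) + 1) * z * I)‖ := by
  have h := ((summable_jacobiTheta₂_term_iff (z / Real.pi + τ / 2) τ).2 hτ).norm.mul_left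
    ‖exp (z * I)‖
  refine h.congr fun k => ?_
  rw [← norm_mul, jacobiTheta₂_term, ← exp_add, ← exp_add]
  have hpi : (Real.pi : ℂ) ≠ 0 := by exact_mod_cast Real.pi_ne_zero
  congr 2
  field_simp
  ring

theorem summable_norm_theta_even_term (z : ℂ) {τ : ℂ} (hτ : 0 < τ.im) :
    Summable fun k : ℤ => ‖exp ((Real.pi : ℂ) * I * τ * ((k : ℂ) ^ 2)) *
      exp (2 * (k : ℂ) * z * I)‖ := by
  refine ((summable_jacobiTheta₂_term_iff (z / Real.pi) τ).2 hτ).norm.congr fun k => ?_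
  rw [jacobiTheta₂_term, ← exp_add]
  have hpi : (Real.pi : ℂ) ≠ 0 := by exact_mod_cast Real.pi_ne_zero
  congr 2
  field_simp
  ring

/-- A sum over `ℤ × ℤ` invariant under `j ↦ -1 - j` is twice its part with `j ≡ k` modulo `2`. -/
theorem tsum_eq_two_mul_tsum_sub_add {f : ℤ × ℤ → ℂ} (hf : Summable f)
    (hsymm : ∀ j k, f (-1 - j, k) = f (j, k)) :
    ∑' p, f p = 2 * ∑' p : ℤ × ℤ, f (p.1 - p.2, p.1 + p.2) := by
  let φ : (ℤ × ℤ) ⊕ (ℤ × ℤ) → ℤ × ℤ :=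
    Sum.elim (fun p => (p.1 - p.2, p.1 + p.2)) (fun p => (-1 - (p.1 - p.2), p.1 + p.2))
  have hφ : Function.Bijective φ := by
    constructor
    · rintro (⟨a, b⟩ | ⟨a, b⟩) (⟨c, d⟩ | ⟨c, d⟩) h <;>
        simp only [φ, Sum.elim_inl, Sum.elim_inr, Prod.mk.injEq, Sum.inl.injEq, Sum.inr.injEq,
          reduceCtorEq] at h ⊢ <;> omega
    · rintro ⟨j, k⟩
      rcases Int.even_or_odd (j + k) with ⟨m, hm⟩ | ⟨m, hm⟩
      · exact ⟨Sum.inl (m, k - m), by simp [φ]; omega⟩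
      · exact ⟨Sum.inr (k - m - 1, m + 1), by simp [φ]; omega⟩
  have hs : Summable fun p : ℤ × ℤ => f (p.1 - p.2, p.1 + p.2) :=
    hf.comp_injective (hφ.1.comp Sum.inl_injective)
  have h := HasSum.sum (f := f ∘ φ) hs.hasSum
    (by simpa [φ, Function.comp_def, hsymm] using hs.hasSum)
  rw [two_mul, ← h.tsum_eq]
  exact ((Equiv.ofBijective φ hφ).tsum_eq f).symm

theorem theta1_theta4_duplication (τ : ℂ) (hτ : 0 < τ.im) (z : ℂ) :
    2 * theta1 z (2 * τ) * theta4 z (2 * τ) = theta2 0 τ * theta1 z τ := by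
  have hτ2 : 0 < (2 * τ).im := by simpa using hτ
  have h1 {σ : ℂ} (hσ : 0 < σ.im) : Summable fun k : ℤ => ‖(-1 : ℂ) ^ k *
      exp ((Real.pi : ℂ) * I * σ * ((k : ℂ) * ((k : ℂ) + 1))) *
        exp ((2 * (k : ℂ) + 1) * z * I)‖ := by
    simpa [norm_mul, norm_zpow] using summable_norm_theta_odd_term z hσ
  have h4 : Summable fun k : ℤ => ‖(-1 : ℂ) ^ k *
      exp ((Real.pi : ℂ) * I * (2 * τ) * ((k : ℂ) ^ 2)) * exp (2 * (k : ℂ) * z * I)‖ := by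
    simpa [norm_mul, norm_zpow] using summable_norm_theta_even_term z hτ2
  have h2 := summable_norm_theta_odd_term 0 hτ
  have hL := tsum_mul_tsum_of_summable_norm (h1 hτ2) h4
  have hR := tsum_mul_tsum_of_summable_norm h2 (h1 hτ)
  rw [tsum_eq_two_mul_tsum_sub_add (summable_mul_of_summable_norm h2 (h1 hτ))] at hR
  · have hq : exp ((Real.pi : ℂ) * I * (2 * τ) / 4) =
        exp ((Real.pi : ℂ) * I * τ / 4) * exp ((Real.pi : ℂ) * I * τ / 4) := by
      rw [← exp_add]
      ring_nf
    have key := hR.trans (congrArg (2 * ·) (Eq.trans (tsum_congr fun p => ?_) hL.symm))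
    · simp only [theta1, theta2, theta4, hq]
      linear_combination I * exp ((Real.pi : ℂ) * I * τ / 4) ^ 2 * key
    · have hsign : (-1 : ℂ) ^ (p.1 + p.2) = (-1) ^ p.1 * (-1) ^ p.2 :=
        zpow_add₀ (by norm_num) _ _
      have hexp (a b c d : ℂ) (s t : ℂ) : exp a * exp b * (s * t * exp c * exp d) =
          s * t * exp (a + b + c + d) := by
        simp only [exp_add]; ring
      have hexp' (a b c d : ℂ) (s t : ℂ) : s * exp a * exp b * (t * exp c * exp d) =
          s * t * exp (a + b + c + d) := by
        simp only [exp_add]; ring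
      rw [hsign, hexp, hexp']
      push_cast
      ring_nf
  · intro j k
    push_cast
    ring_nf
end

section
/- For any τ in the upper half-plane and every complex number y, one has θ₁(y|2τ)·θ₄(y|2τ)·θ₂(y|τ) = θ₂(y|2τ)·θ₃(y|2τ)·θ₁(y|τ). -/
open Complex

lemma summable_norm_exp_quadratic {a : ℂ} (ha : a.re < 0) (b : ℂ) :
    Summable fun k : ℤ ↦ ‖exp (a * (k : ℂ) ^ 2 + b * k)‖ := by
  have hpi : (Real.pi : ℂ) ≠ 0 := by exact_mod_cast Real.pi_ne_zero
  have him : 0 < (-I * a / (Real.pi : ℂ)).im := by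
    rw [Complex.div_ofReal_im]
    simpa using div_pos (neg_pos.2 ha) Real.pi_pos
  refine ((summable_jacobiTheta₂_term_iff (-I * b / (2 * Real.pi)) _).2 him).norm.congr
    fun k ↦ ?_
  rw [jacobiTheta₂_term]
  congr 2
  field_simp
  linear_combination (-(b * k) - a * (k : ℂ) ^ 2) * I_sq

lemma tsum_exp_parity_class (A : ℂ) (n : ℤ) :
    ∑' m : ℤ, exp (A * (((n : ℂ) - 2 * m) * ((n : ℂ) - 2 * m + 1))) =
      ∑' m : ℤ, exp (A * (2 * (m : ℂ) * (2 * m + 1))) := by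
  obtain ⟨a, rfl | rfl⟩ := Int.even_or_odd' n
  · rw [← (Equiv.subLeft a).tsum_eq]
    refine tsum_congr fun m ↦ ?_
    simp only [Equiv.subLeft_apply]
    push_cast
    congr 1
    ring
  · rw [← (Equiv.addLeft (a + 1)).tsum_eq]
    refine tsum_congr fun m ↦ ?_
    simp only [Equiv.coe_addLeft]
    push_cast
    congr 1
    ring

/-- A signed form of the Landen-type product formula: `ε = 1` relates `θ₂θ₃` at `2τ` to `θ₂` at `τ`,
and `ε = -1` relates `θ₁θ₄` at `2τ` to `θ₁` at `τ`, with the same constant. -/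
lemma tsum_mul_tsum_theta {A : ℂ} (hA : A.re < 0) (w : ℂ) {ε : ℂ} (hε : ‖ε‖ = 1) :
    (∑' k : ℤ, ε ^ k * exp (2 * A * ((k : ℂ) * ((k : ℂ) + 1))) * exp ((2 * (k : ℂ) + 1) * w)) *
      (∑' m : ℤ, ε ^ m * exp (2 * A * ((m : ℂ) ^ 2)) * exp (2 * (m : ℂ) * w)) =
    (∑' m : ℤ, exp (A * (2 * (m : ℂ) * (2 * m + 1)))) *
      ∑' n : ℤ, ε ^ n * exp (A * ((n : ℂ) * ((n : ℂ) + 1))) * exp ((2 * (n : ℂ) + 1) * w) := by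
  have hε0 : ε ≠ 0 := by
    rintro rfl
    simp at hε
  have h2A : (2 * A).re < 0 := by
    rw [mul_re, re_ofNat, im_ofNat]
    linarith
  have hf : Summable fun k : ℤ ↦
      ‖ε ^ k * exp (2 * A * ((k : ℂ) * ((k : ℂ) + 1))) * exp ((2 * (k : ℂ) + 1) * w)‖ := by
    refine ((summable_norm_exp_quadratic h2A (2 * A + 2 * w)).mul_right ‖exp w‖).congr fun k ↦ ?_
    rw [mul_assoc (ε ^ k), norm_mul (ε ^ k), norm_zpow, hε, one_zpow, one_mul, ← norm_mul, ← exp_add,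
      ← exp_add]
    congr 2
    ring
  have hg : Summable fun m : ℤ ↦ ‖ε ^ m * exp (2 * A * ((m : ℂ) ^ 2)) * exp (2 * (m : ℂ) * w)‖ := by
    refine (summable_norm_exp_quadratic h2A (2 * w)).congr fun m ↦ ?_
    rw [mul_assoc (ε ^ m), norm_mul (ε ^ m), norm_zpow, hε, one_zpow, one_mul, ← exp_add]
    congr 2
    ring
  let e : ℤ × ℤ ≃ ℤ × ℤ :=
    { toFun := fun p ↦ (p.1 - p.2, p.2)
      invFun := fun p ↦ (p.1 + p.2, p.2)
      left_inv := fun p ↦ by simp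
      right_inv := fun p ↦ by simp }
  have hs := e.summable_iff.2 (summable_mul_of_summable_norm hf hg)
  rw [tsum_mul_tsum_of_summable_norm hf hg, ← e.tsum_eq]
  refine (hs.tsum_prod).trans ?_
  rw [← tsum_mul_left]
  refine tsum_congr fun n ↦ ?_
  rw [← tsum_exp_parity_class A n, ← tsum_mul_right]
  refine tsum_congr fun m ↦ ?_
  have hsign : ε ^ n = ε ^ (n - m) * ε ^ m := by rw [← zpow_add₀ hε0, sub_add_cancel]
  have hexp : exp (2 * A * (((n : ℂ) - m) * ((n : ℂ) - m + 1))) *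
      exp ((2 * ((n : ℂ) - m) + 1) * w) * (exp (2 * A * (m : ℂ) ^ 2) * exp (2 * (m : ℂ) * w)) =
      exp (A * (((n : ℂ) - 2 * m) * ((n : ℂ) - 2 * m + 1))) *
        (exp (A * ((n : ℂ) * ((n : ℂ) + 1))) * exp ((2 * (n : ℂ) + 1) * w)) := by
    simp only [← exp_add]
    congr 1
    ring
  simp only [Function.comp_apply, e, Equiv.coe_fn_mk, hsign]
  push_cast
  linear_combination ε ^ (n - m) * ε ^ m * hexp

theorem theta_triple_product_relation (τ : ℂ) (hτ : 0 < τ.im) (y : ℂ) :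
    theta1 y (2 * τ) * theta4 y (2 * τ) * theta2 y τ =
    theta2 y (2 * τ) * theta3 y (2 * τ) * theta1 y τ := by
  have hA : ((Real.pi : ℂ) * I * τ).re < 0 := by
    simpa using mul_pos Real.pi_pos hτ
  have h₁ := tsum_mul_tsum_theta hA (y * I) (ε := 1) (by simp)
  have h₂ := tsum_mul_tsum_theta hA (y * I) (ε := -1) (by simp)
  simp only [one_zpow, one_mul] at h₁
  have hmul : (Real.pi : ℂ) * I * (2 * τ) = 2 * ((Real.pi : ℂ) * I * τ) := by ring
  simp only [theta1, theta2, theta3, theta4, hmul, mul_assoc _ y I]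
  generalize (Real.pi : ℂ) * I * τ = A at *
  generalize (∑' k : ℤ, exp (A * ((k : ℂ) * ((k : ℂ) + 1))) * exp ((2 * (k : ℂ) + 1) * (y * I))) = S
    at *
  generalize (∑' k : ℤ, (-1 : ℂ) ^ k * exp (A * ((k : ℂ) * ((k : ℂ) + 1))) *
    exp ((2 * (k : ℂ) + 1) * (y * I))) = R at *
  linear_combination (-I * exp (2 * A / 4) * exp (A / 4)) * (S * h₂ - R * h₁)
end

section
/- For any τ in the upper half-plane with q = exp(πiτ), and every complex number z, the Jacobi infinite product expression θ₁(z|τ) = 2 q^{1/4} sin z · (q²;q²)_∞ · (q² e^{2iz};q²)_∞ · (q² e^{−2iz};q²)_∞ holds. -/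
open Complex

/-- The q-shifted factorial (a;q)_∞ = ∏_{n≥0} (1 - a qⁿ). -/
noncomputable def qpoch (a q : ℂ) : ℂ := ∏' n : ℕ, (1 - a * q ^ n)

open Filter Topology

/-- The reciprocal `1 / (Q;Q)_n` of the finite `Q`-factorial, extended by `0` to negative `n`. -/
noncomputable def invQFactorial (Q : ℂ) (n : ℤ) : ℂ :=
  if 0 ≤ n then (∏ j ∈ Finset.range n.toNat, (1 - Q * Q ^ j))⁻¹ else 0

lemma invQFactorial_natCast (Q : ℂ) (n : ℕ) :
    invQFactorial Q n = (∏ j ∈ Finset.range n, (1 - Q * Q ^ j))⁻¹ := by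
  simp [invQFactorial]

lemma invQFactorial_of_neg (Q : ℂ) {n : ℤ} (hn : n < 0) : invQFactorial Q n = 0 := by
  simp [invQFactorial, hn]

lemma one_sub_mul_pow_ne_zero {Q : ℂ} (hQ : ‖Q‖ < 1) (j : ℕ) : 1 - Q * Q ^ j ≠ 0 := by
  rw [sub_ne_zero, ← pow_succ']
  intro h
  have h1 : ‖Q‖ ^ (j + 1) < 1 := pow_lt_one₀ (norm_nonneg _) hQ (Nat.succ_ne_zero j)
  rw [← norm_pow, ← h, norm_one] at h1
  exact lt_irrefl _ h1

lemma invQFactorial_sub_one {Q : ℂ} (hQ : ‖Q‖ < 1) (n : ℤ) :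
    invQFactorial Q (n - 1) = (1 - Q ^ n) * invQFactorial Q n := by
  rcases lt_trichotomy n 0 with hn | rfl | hn
  · rw [invQFactorial_of_neg Q hn, invQFactorial_of_neg Q (by lia), mul_zero]
  · rw [invQFactorial_of_neg Q (by lia)]
    simp
  · obtain ⟨m, rfl⟩ : ∃ m : ℕ, n = ((m + 1 : ℕ) : ℤ) := ⟨(n - 1).toNat, by lia⟩
    have hm : ((m + 1 : ℕ) : ℤ) - 1 = m := by push_cast; ring
    rw [hm, invQFactorial_natCast, invQFactorial_natCast, Finset.prod_range_succ, mul_inv,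
      zpow_natCast, pow_succ']
    have h := one_sub_mul_pow_ne_zero hQ m
    field_simp

/-- The finite form of the Jacobi triple product, for a two-sided sequence `a` satisfying the
recursion of `(-1) ^ k * Q ^ (k * (k + 1) / 2) * w ^ k`. -/
lemma hasSum_finite_tripleProduct {Q w : ℂ} (hQ : ‖Q‖ < 1) (hQ0 : Q ≠ 0) (hw : w ≠ 0)
    {a : ℤ → ℂ} (ha0 : a 0 = 1) (ha : ∀ k, a k = -(w * Q ^ k * a (k - 1))) (A B : ℕ) :
    HasSum (fun k : ℤ ↦ (∏ j ∈ Finset.range (A + B), (1 - Q * Q ^ j)) *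
        (invQFactorial Q (A - k) * invQFactorial Q (B + k)) * a k)
      ((∏ j ∈ Finset.range A, (1 - Q * w * Q ^ j)) * ∏ j ∈ Finset.range B, (1 - w⁻¹ * Q ^ j)) := by
  induction B with
  | zero =>
    induction A with
    | zero =>
      convert hasSum_single (0 : ℤ) ?_ using 1
      · simp [ha0, invQFactorial]
      · intro k hk
        rcases lt_or_gt_of_ne hk with h | h
        · rw [invQFactorial_of_neg Q (n := _ + k) (by push_cast; lia)]
          simp
        · rw [invQFactorial_of_neg Q (n := _ - k) (by push_cast; lia)]
          simp
    | succ A ih =>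
      have h1 := ((Equiv.subRight (1 : ℤ)).hasSum_iff.mpr ih).mul_left (Q * w * Q ^ A)
      convert ih.sub h1 using 1
      · rfl
      · funext k
        simp only [Function.comp_apply, Equiv.subRight_apply]
        have e1 := invQFactorial_sub_one hQ ((A + 1 : ℤ) - k)
        have e2 := invQFactorial_sub_one hQ (((0 : ℕ) : ℤ) + k)
        have i1 : (A + 1 : ℤ) - k - 1 = A - k := by ring
        have i2 : (A : ℤ) - (k - 1) = A + 1 - k := by ring
        rw [i1] at e1
        rw [i2, ← add_sub_assoc, e1, e2, ha k, show A + 1 + 0 = (A + 0) + 1 by ring,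
          Finset.prod_range_succ, zpow_sub₀ hQ0, zpow_add₀ hQ0, zpow_add₀ hQ0]
        have hk : Q ^ k ≠ 0 := zpow_ne_zero _ hQ0
        push_cast
        simp only [zpow_natCast, zpow_one, add_zero, zpow_zero]
        field_simp
        ring
      · rw [Finset.prod_range_succ]
        ring
  | succ B ih =>
    have h1 := ((Equiv.addRight (1 : ℤ)).hasSum_iff.mpr ih).mul_left (w⁻¹ * Q ^ B)
    convert ih.sub h1 using 1
    · rfl
    · funext k
      simp only [Function.comp_apply, Equiv.coe_addRight]
      have e1 := invQFactorial_sub_one hQ ((A : ℤ) - k)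
      have e2 := invQFactorial_sub_one hQ ((B : ℤ) + 1 + k)
      have i1 : (A : ℤ) - (k + 1) = A - k - 1 := by ring
      have i2 : (B : ℤ) + 1 + k - 1 = B + k := by ring
      have i3 : (B : ℤ) + (k + 1) = B + 1 + k := by ring
      have ha1 := ha (k + 1)
      rw [add_sub_cancel_right] at ha1
      rw [i2] at e2
      rw [i1, i3, e1, e2, ha1, ← add_assoc A B 1,
        Finset.prod_range_succ, zpow_sub₀ hQ0, zpow_add₀ hQ0, zpow_add₀ hQ0, zpow_add₀ hQ0]
      have hk : Q ^ k ≠ 0 := zpow_ne_zero _ hQ0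
      push_cast
      simp only [zpow_natCast, zpow_one]
      field_simp
      ring
    · rw [Finset.prod_range_succ]
      ring

lemma summable_norm_mul_pow {Q : ℂ} (hQ : ‖Q‖ < 1) (x : ℂ) :
    Summable fun n : ℕ ↦ ‖-(x * Q ^ n)‖ := by
  simpa using (summable_geometric_of_lt_one (norm_nonneg _) hQ).mul_left ‖x‖

lemma multipliable_qpoch {Q : ℂ} (hQ : ‖Q‖ < 1) (x : ℂ) :
    Multipliable fun n : ℕ ↦ 1 - x * Q ^ n := by
  simpa only [sub_eq_add_neg] using
    multipliable_one_add_of_summable (f := fun n : ℕ ↦ -(x * Q ^ n)) (summable_norm_mul_pow hQ x)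

lemma tendsto_prod_range_qpoch {Q : ℂ} (hQ : ‖Q‖ < 1) (x : ℂ) :
    Tendsto (fun n ↦ ∏ j ∈ Finset.range n, (1 - x * Q ^ j)) atTop (𝓝 (qpoch x Q)) :=
  (multipliable_qpoch hQ x).hasProd.tendsto_prod_nat

lemma qpoch_self_ne_zero {Q : ℂ} (hQ : ‖Q‖ < 1) : qpoch Q Q ≠ 0 := by
  have := tprod_one_add_ne_zero_of_summable (f := fun n : ℕ ↦ -(Q * Q ^ n))
    (fun n ↦ by simpa [← sub_eq_add_neg] using one_sub_mul_pow_ne_zero hQ n)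
    (summable_norm_mul_pow hQ Q)
  simpa [qpoch, sub_eq_add_neg] using this

lemma qpoch_eq_one_sub_mul {Q : ℂ} (hQ : ‖Q‖ < 1) (x : ℂ) :
    qpoch x Q = (1 - x) * qpoch (Q * x) Q := by
  have h : ∀ n : ℕ, 1 - x * Q ^ (n + 1) = 1 - Q * x * Q ^ n := fun n ↦ by ring
  rw [qpoch, tprod_eq_zero_mul' (by simpa only [h] using multipliable_qpoch hQ (Q * x))]
  simp only [h, pow_zero, mul_one, qpoch]

lemma tendsto_invQFactorial {Q : ℂ} (hQ : ‖Q‖ < 1) :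
    Tendsto (invQFactorial Q) atTop (𝓝 (qpoch Q Q)⁻¹) := by
  rw [← Nat.map_cast_int_atTop, tendsto_map'_iff]
  simpa [Function.comp_def, invQFactorial_natCast] using
    (tendsto_prod_range_qpoch hQ Q).inv₀ (qpoch_self_ne_zero hQ)

lemma exists_norm_le_of_tendsto_atTop {u : ℕ → ℂ} {l : ℂ} (hu : Tendsto u atTop (𝓝 l)) :
    ∃ C, 0 ≤ C ∧ ∀ n, ‖u n‖ ≤ C := by
  obtain ⟨C, hC⟩ := (Metric.isBounded_range_of_tendsto u hu).exists_norm_le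
  have h : ∀ n, ‖u n‖ ≤ C := fun n ↦ hC _ ⟨n, rfl⟩
  exact ⟨C, (norm_nonneg _).trans (h 0), h⟩

lemma exists_norm_invQFactorial_le {Q : ℂ} (hQ : ‖Q‖ < 1) :
    ∃ C, 0 ≤ C ∧ ∀ n, ‖invQFactorial Q n‖ ≤ C := by
  obtain ⟨C, hC0, hC⟩ := exists_norm_le_of_tendsto_atTop
    ((tendsto_invQFactorial hQ).comp tendsto_natCast_atTop_atTop)
  refine ⟨C, hC0, fun n ↦ ?_⟩
  rcases lt_or_ge n 0 with hn | hn
  · simpa [invQFactorial_of_neg Q hn] using hC0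
  · lift n to ℕ using hn
    exact hC n

/-- The Jacobi triple product, for a summable two-sided sequence `a` satisfying the recursion of
`(-1) ^ k * Q ^ (k * (k + 1) / 2) * w ^ k`. -/
lemma tsum_eq_tripleProduct {Q w : ℂ} (hQ : ‖Q‖ < 1) (hQ0 : Q ≠ 0) (hw : w ≠ 0)
    {a : ℤ → ℂ} (ha0 : a 0 = 1) (ha : ∀ k, a k = -(w * Q ^ k * a (k - 1))) (hs : Summable a) :
    ∑' k, a k = qpoch Q Q * qpoch (Q * w) Q * qpoch w⁻¹ Q := by
  obtain ⟨C, hC0, hC⟩ := exists_norm_invQFactorial_le hQ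
  obtain ⟨D, hD0, hD⟩ := exists_norm_le_of_tendsto_atTop (tendsto_prod_range_qpoch hQ Q)
  have hP := qpoch_self_ne_zero hQ
  have hlim : Tendsto (fun n : ℕ ↦ ∑' k : ℤ, (∏ j ∈ Finset.range (n + n), (1 - Q * Q ^ j)) *
      (invQFactorial Q (n - k) * invQFactorial Q (n + k)) * a k) atTop
      (𝓝 (∑' k, (qpoch Q Q * ((qpoch Q Q)⁻¹ * (qpoch Q Q)⁻¹)) * a k)) := by
    refine tendsto_tsum_of_dominated_convergence (hs.norm.mul_left (D * (C * C))) (fun k ↦ ?_)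
      (.of_forall fun n k ↦ ?_)
    · have hn : Tendsto (fun n : ℕ ↦ (n : ℤ)) atTop atTop := tendsto_natCast_atTop_atTop
      refine Tendsto.mul_const _ (Tendsto.mul ?_ (Tendsto.mul ?_ ?_))
      · exact (tendsto_prod_range_qpoch hQ Q).comp (tendsto_id.atTop_add_atTop tendsto_id)
      · exact (tendsto_invQFactorial hQ).comp (tendsto_atTop_add_const_right _ (-k) hn)
      · exact (tendsto_invQFactorial hQ).comp (tendsto_atTop_add_const_right _ k hn)
    · rw [norm_mul, norm_mul, norm_mul]
      gcongr
      exacts [hD _, hC _, hC _]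
  have hfin := fun n : ℕ ↦ (hasSum_finite_tripleProduct hQ hQ0 hw ha0 ha n n).tsum_eq
  simp_rw [hfin] at hlim
  have := tendsto_nhds_unique hlim
    ((tendsto_prod_range_qpoch hQ (Q * w)).mul (tendsto_prod_range_qpoch hQ w⁻¹))
  rw [tsum_mul_left] at this
  rw [mul_assoc, ← this]
  field_simp

lemma summable_theta1_term {τ : ℂ} (hτ : 0 < τ.im) (z : ℂ) :
    Summable fun k : ℤ ↦ (-1 : ℂ) ^ k * exp ((Real.pi : ℂ) * I * τ * ((k : ℂ) * ((k : ℂ) + 1))) *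
      exp (2 * z * I) ^ k := by
  refine ((summable_jacobiTheta₂_term_iff (τ / 2 + z / Real.pi) τ).mpr hτ).norm.of_norm_bounded
    fun k ↦ le_of_eq ?_
  have hpi : (Real.pi : ℂ) ≠ 0 := ofReal_ne_zero.mpr Real.pi_ne_zero
  rw [mul_assoc, norm_mul, norm_zpow, norm_neg, norm_one, one_zpow, one_mul, ← exp_int_mul,
    ← exp_add, jacobiTheta₂_term]
  congr 2
  field_simp
  ring

theorem theta1_product_formula (τ : ℂ) (hτ : 0 < τ.im) (z : ℂ) :
    theta1 z τ =
      2 * exp ((Real.pi : ℂ) * I * τ / 4) * Complex.sin z *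
        qpoch (exp ((Real.pi : ℂ) * I * τ) ^ 2) (exp ((Real.pi : ℂ) * I * τ) ^ 2) *
        qpoch (exp ((Real.pi : ℂ) * I * τ) ^ 2 * exp (2 * z * I)) (exp ((Real.pi : ℂ) * I * τ) ^ 2) *
        qpoch (exp ((Real.pi : ℂ) * I * τ) ^ 2 * exp (-(2 * z * I))) (exp ((Real.pi : ℂ) * I * τ) ^ 2) := by
  set q := exp ((Real.pi : ℂ) * I * τ) with hq
  have hq0 : q ≠ 0 := exp_ne_zero _
  have hQ : ‖q ^ 2‖ < 1 := by
    rw [norm_pow]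
    refine pow_lt_one₀ (norm_nonneg _) ?_ two_ne_zero
    rw [hq, norm_exp, Real.exp_lt_one_iff]
    simpa using mul_pos Real.pi_pos hτ
  have key := tsum_eq_tripleProduct (w := exp (2 * z * I)) hQ (pow_ne_zero 2 hq0) (exp_ne_zero _)
    (by simp) (fun k ↦ ?_) (summable_theta1_term hτ z)
  · rw [← exp_neg, qpoch_eq_one_sub_mul hQ (exp (-(2 * z * I)))] at key
    have hterm : ∀ k : ℤ, exp ((2 * (k : ℂ) + 1) * z * I) =
        exp (2 * z * I) ^ k * exp (z * I) := fun k ↦ by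
      rw [← exp_int_mul, ← exp_add]
      ring_nf
    have hsin : exp (z * I) * (1 - exp (-(2 * z * I))) = 2 * I * Complex.sin z := by
      rw [mul_sub, ← exp_add, show z * I + -(2 * z * I) = -z * I by ring, Complex.sin]
      linear_combination (exp (z * I) - exp (-z * I)) * I_sq
    rw [theta1]
    simp_rw [hterm, ← mul_assoc]
    rw [tsum_mul_right]
    simp_rw [← mul_assoc] at key
    rw [key]
    linear_combination (-I * exp ((Real.pi : ℂ) * I * τ / 4) * qpoch (q ^ 2) (q ^ 2) *
      qpoch (q ^ 2 * exp (2 * z * I)) (q ^ 2) * qpoch (q ^ 2 * exp (-(2 * z * I))) (q ^ 2)) * hsin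
      - 2 * exp ((Real.pi : ℂ) * I * τ / 4) * Complex.sin z * qpoch (q ^ 2) (q ^ 2) *
      qpoch (q ^ 2 * exp (2 * z * I)) (q ^ 2) * qpoch (q ^ 2 * exp (-(2 * z * I))) (q ^ 2) * I_sq
  · have e : exp ((Real.pi : ℂ) * I * τ * ((k : ℂ) * ((k : ℂ) + 1))) = (q ^ 2) ^ k *
        exp ((Real.pi : ℂ) * I * τ * (((k - 1 : ℤ) : ℂ) * (((k - 1 : ℤ) : ℂ) + 1))) := by
      rw [hq, ← exp_nat_mul, ← exp_int_mul, ← exp_add]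
      push_cast
      ring_nf
    rw [e, zpow_sub_one₀ (exp_ne_zero _), zpow_sub_one₀ (by norm_num : (-1 : ℂ) ≠ 0)]
    have := exp_ne_zero (2 * z * I)
    field_simp
end

section
/- For any τ in the upper half-plane with q = exp(πiτ), and every complex number z, the Jacobi infinite product expression θ₄(z|τ) = (q²;q²)_∞ · (q e^{2iz};q²)_∞ · (q e^{−2iz};q²)_∞ holds. -/
open Complex

open Filter Topology Finset

/-- The finite q-shifted factorial `(a;q)_n = ∏_{i<n} (1 - a qⁱ)`. -/
noncomputable def qpochFin (a q : ℂ) (n : ℕ) : ℂ := ∏ i ∈ range n, (1 - a * q ^ i)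

lemma qpochFin_succ (a q : ℂ) (n : ℕ) :
    qpochFin a q (n + 1) = qpochFin a q n * (1 - a * q ^ n) :=
  prod_range_succ _ _

lemma summable_norm_neg_mul_pow (a : ℂ) {q : ℂ} (hq : ‖q‖ < 1) :
    Summable fun n : ℕ ↦ ‖-(a * q ^ n)‖ := by
  simpa [norm_mul, norm_pow] using
    (summable_geometric_of_lt_one (norm_nonneg q) hq).mul_left ‖a‖

lemma tendsto_qpochFin (a : ℂ) {q : ℂ} (hq : ‖q‖ < 1) :
    Tendsto (qpochFin a q) atTop (𝓝 (qpoch a q)) := by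
  have h := (multipliable_one_add_of_summable
    (summable_norm_neg_mul_pow a hq)).hasProd.tendsto_prod_nat
  simp only [← sub_eq_add_neg] at h
  exact h

lemma one_sub_mul_pow_self_ne_zero {q : ℂ} (hq : ‖q‖ < 1) (n : ℕ) : 1 - q * q ^ n ≠ 0 := by
  rw [← pow_succ']
  intro h
  have h1 : ‖q ^ (n + 1)‖ < 1 := by
    rw [norm_pow]
    exact pow_lt_one₀ (norm_nonneg q) hq n.succ_ne_zero
  rw [← sub_eq_zero.mp h, norm_one] at h1
  exact lt_irrefl _ h1

lemma qpochFin_self_ne_zero {q : ℂ} (hq : ‖q‖ < 1) (n : ℕ) : qpochFin q q n ≠ 0 :=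
  prod_ne_zero_iff.mpr fun i _ ↦ one_sub_mul_pow_self_ne_zero hq i

lemma qpoch_self_ne_zero_s12 {q : ℂ} (hq : ‖q‖ < 1) : qpoch q q ≠ 0 := by
  have h := tprod_one_add_ne_zero_of_summable (f := fun n : ℕ ↦ -(q * q ^ n))
    (fun n ↦ by simpa only [← sub_eq_add_neg] using one_sub_mul_pow_self_ne_zero hq n)
    (summable_norm_neg_mul_pow q hq)
  simp only [← sub_eq_add_neg] at h
  exact h

/-- The reciprocal `1 / (q;q)_m`, extended by zero to negative integers `m`. -/
noncomputable def invQpoch (q : ℂ) (m : ℤ) : ℂ :=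
  if 0 ≤ m then (qpochFin q q m.toNat)⁻¹ else 0

lemma invQpoch_sub_one {q : ℂ} (hq : ‖q‖ < 1) (m : ℤ) :
    invQpoch q (m - 1) = (1 - q ^ m) * invQpoch q m := by
  rcases lt_trichotomy m 0 with hm | rfl | hm
  · simp [invQpoch, show ¬ (1 ≤ m) by omega, show ¬ (0 ≤ m) by omega]
  · simp [invQpoch]
  · obtain ⟨k, rfl⟩ : ∃ k : ℕ, m = k + 1 := ⟨(m - 1).toNat, by omega⟩
    have h1 := one_sub_mul_pow_self_ne_zero hq k
    have h2 := qpochFin_self_ne_zero hq k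
    have h4 : q ^ ((k : ℤ) + 1) = q * q ^ k := by
      rw [← pow_succ']
      exact_mod_cast zpow_natCast q (k + 1)
    have h5 : ((k : ℤ) + 1).toNat = k + 1 := by omega
    rw [h4, invQpoch, invQpoch, if_pos (by omega), if_pos (by omega), h5, qpochFin_succ,
      add_sub_cancel_right, Int.toNat_natCast]
    field_simp

lemma tendsto_invQpoch {q : ℂ} (hq : ‖q‖ < 1) :
    Tendsto (invQpoch q) atTop (𝓝 (qpoch q q)⁻¹) := by
  have hnat : Tendsto Int.toNat atTop atTop :=
    tendsto_atTop.mpr fun b ↦ (eventually_ge_atTop (b : ℤ)).mono fun m hm ↦ by omega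
  refine (((tendsto_qpochFin q hq).comp hnat).inv₀ (qpoch_self_ne_zero_s12 hq)).congr' ?_
  filter_upwards [eventually_ge_atTop 0] with m hm
  simp [invQpoch, hm]

lemma exists_norm_qpochFin_le (a : ℂ) {q : ℂ} (hq : ‖q‖ < 1) :
    ∃ C, ∀ n, ‖qpochFin a q n‖ ≤ C := by
  obtain ⟨C, hC⟩ := (tendsto_qpochFin a hq).norm.bddAbove_range
  exact ⟨C, fun n ↦ hC ⟨n, rfl⟩⟩

lemma exists_norm_invQpoch_le {q : ℂ} (hq : ‖q‖ < 1) :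
    ∃ C, ∀ m, ‖invQpoch q m‖ ≤ C := by
  obtain ⟨C, hC⟩ :=
    ((tendsto_qpochFin q hq).inv₀ (qpoch_self_ne_zero_s12 hq)).norm.bddAbove_range
  refine ⟨C, fun m ↦ ?_⟩
  have h (n : ℕ) : ‖(qpochFin q q n)⁻¹‖ ≤ C := hC ⟨n, rfl⟩
  rw [invQpoch]
  split_ifs
  · exact h _
  · simpa using (norm_nonneg _).trans (h 0)

/-- The term `(-1)ⁿ q^{n²} wⁿ` of the theta series. -/
noncomputable def thetaTerm (q w : ℂ) (n : ℤ) : ℂ := (-1) ^ n * q ^ (n ^ 2) * w ^ n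

/-- The `q²`-binomial coefficient `[2N choose N + n]`. -/
noncomputable def centralQBinom (q : ℂ) (N : ℕ) (n : ℤ) : ℂ :=
  qpochFin (q ^ 2) (q ^ 2) (2 * N) * invQpoch (q ^ 2) (N + n) * invQpoch (q ^ 2) (N - n)

lemma norm_sq_lt_one {q : ℂ} (hq : ‖q‖ < 1) : ‖q ^ 2‖ < 1 := by
  rw [norm_pow]
  exact pow_lt_one₀ (norm_nonneg q) hq two_ne_zero

lemma thetaTerm_sub_one {q w : ℂ} (hq0 : q ≠ 0) (hw : w ≠ 0) (n : ℤ) :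
    thetaTerm q w (n - 1) = -(thetaTerm q w n * (q / ((q ^ n) ^ 2 * w))) := by
  have h : q ^ ((n - 1) ^ 2) = q ^ (n ^ 2) * q / (q ^ n) ^ 2 := by
    rw [show (n - 1) ^ 2 = n ^ 2 + 1 - n * 2 by ring, zpow_sub₀ hq0, zpow_add_one₀ hq0, zpow_mul]
    norm_cast
  rw [thetaTerm, thetaTerm, h, zpow_sub_one₀ hw, zpow_sub_one₀ (by norm_num)]
  have := zpow_ne_zero n hq0
  field_simp

lemma thetaTerm_add_one {q w : ℂ} (hq0 : q ≠ 0) (hw : w ≠ 0) (n : ℤ) :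
    thetaTerm q w (n + 1) = -(thetaTerm q w n * (q * (q ^ n) ^ 2 * w)) := by
  have h : q ^ ((n + 1) ^ 2) = q ^ (n ^ 2) * q * (q ^ n) ^ 2 := by
    rw [show (n + 1) ^ 2 = n ^ 2 + 1 + n * 2 by ring, zpow_add₀ hq0, zpow_add_one₀ hq0, zpow_mul]
    norm_cast
  rw [thetaTerm, thetaTerm, h, zpow_add_one₀ hw, zpow_add_one₀ (by norm_num)]
  ring

lemma centralQBinom_succ {q : ℂ} (hq : ‖q‖ < 1) (hq0 : q ≠ 0) (N : ℕ) (n : ℤ) :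
    centralQBinom q (N + 1) n =
      (1 + q ^ (4 * N + 2)) * centralQBinom q N n +
      q ^ (2 * N + 2) / (q ^ n) ^ 2 * centralQBinom q N (n - 1) +
      q ^ (2 * N + 2) * (q ^ n) ^ 2 * centralQBinom q N (n + 1) := by
  have hQ := norm_sq_lt_one hq
  have hg := zpow_ne_zero n hq0
  have hP : qpochFin (q ^ 2) (q ^ 2) (2 * (N + 1)) = qpochFin (q ^ 2) (q ^ 2) (2 * N) *
      (1 - q ^ (4 * N + 2)) * (1 - q ^ (4 * N + 4)) := by
    rw [show 2 * (N + 1) = 2 * N + 1 + 1 by ring, qpochFin_succ, qpochFin_succ]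
    ring
  have e1 : (q ^ 2) ^ ((N : ℤ) + 1 + n) = q ^ (2 * N + 2) * (q ^ n) ^ 2 := by
    rw [zpow_add₀ (pow_ne_zero 2 hq0), ← zpow_natCast q 2, zpow_comm q _ n, zpow_natCast,
      zpow_natCast, ← Nat.cast_succ, zpow_natCast, Nat.succ_eq_add_one]
    ring
  have e2 : (q ^ 2) ^ ((N : ℤ) + 1 - n) = q ^ (2 * N + 2) / (q ^ n) ^ 2 := by
    rw [zpow_sub₀ (pow_ne_zero 2 hq0), ← zpow_natCast q 2, zpow_comm q _ n, zpow_natCast,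
      zpow_natCast, ← Nat.cast_succ, zpow_natCast, Nat.succ_eq_add_one]
    ring
  have e3 : (q ^ 2) ^ ((N : ℤ) + n) = q ^ (2 * N) * (q ^ n) ^ 2 := by
    rw [show (N : ℤ) + n = N + 1 + n - 1 by ring, zpow_sub_one₀ (pow_ne_zero 2 hq0), e1]
    field_simp
    ring
  have e4 : (q ^ 2) ^ ((N : ℤ) - n) = q ^ (2 * N) / (q ^ n) ^ 2 := by
    rw [show (N : ℤ) - n = N + 1 - n - 1 by ring, zpow_sub_one₀ (pow_ne_zero 2 hq0), e2]
    field_simp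
    ring
  have a1 : invQpoch (q ^ 2) (N + n) =
      (1 - q ^ (2 * N + 2) * (q ^ n) ^ 2) * invQpoch (q ^ 2) (N + 1 + n) := by
    have := invQpoch_sub_one hQ (N + 1 + n)
    rwa [show (N : ℤ) + 1 + n - 1 = N + n by ring, e1] at this
  have a2 : invQpoch (q ^ 2) (N - n) =
      (1 - q ^ (2 * N + 2) / (q ^ n) ^ 2) * invQpoch (q ^ 2) (N + 1 - n) := by
    have := invQpoch_sub_one hQ (N + 1 - n)
    rwa [show (N : ℤ) + 1 - n - 1 = N - n by ring, e2] at this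
  have a3 : invQpoch (q ^ 2) (N + n - 1) =
      (1 - q ^ (2 * N) * (q ^ n) ^ 2) * ((1 - q ^ (2 * N + 2) * (q ^ n) ^ 2) * invQpoch (q ^ 2) (N + 1 + n)) := by
    have := invQpoch_sub_one hQ (N + n)
    rwa [e3, a1] at this
  have a4 : invQpoch (q ^ 2) (N - n - 1) =
      (1 - q ^ (2 * N) / (q ^ n) ^ 2) * ((1 - q ^ (2 * N + 2) / (q ^ n) ^ 2) * invQpoch (q ^ 2) (N + 1 - n)) := by
    have := invQpoch_sub_one hQ (N - n)
    rwa [e4, a2] at this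
  simp only [centralQBinom]
  rw [hP, show (N : ℤ) + (n - 1) = N + n - 1 by ring, show (N : ℤ) - (n - 1) = N + 1 - n by ring,
    show (N : ℤ) - (n + 1) = N - n - 1 by ring, show (N : ℤ) + (n + 1) = N + 1 + n by ring,
    a3, a4, a1, a2]
  push_cast
  field_simp
  ring

/-- The finite form of the Jacobi triple product identity. -/
lemma hasSum_thetaTerm_mul_centralQBinom {q w : ℂ} (hq : ‖q‖ < 1) (hq0 : q ≠ 0) (hw : w ≠ 0)
    (N : ℕ) : HasSum (fun n ↦ thetaTerm q w n * centralQBinom q N n)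
      (qpochFin (q * w) (q ^ 2) N * qpochFin (q * w⁻¹) (q ^ 2) N) := by
  induction N with
  | zero =>
    convert hasSum_single (0 : ℤ) ?_ using 1
    · simp [qpochFin, thetaTerm, centralQBinom, invQpoch]
    · intro n hn
      rcases lt_or_gt_of_ne hn with h | h
      · simp [centralQBinom, invQpoch, h.not_ge]
      · simp [centralQBinom, invQpoch, h.not_ge]
  | succ N ih =>
    have hm := (Equiv.subRight (1 : ℤ)).hasSum_iff.mpr ih
    have hp := (Equiv.addRight (1 : ℤ)).hasSum_iff.mpr ih
    convert ((ih.mul_left (1 + q ^ (4 * N + 2))).sub (hm.mul_left (q ^ (2 * N + 1) * w))).sub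
      (hp.mul_left (q ^ (2 * N + 1) * w⁻¹)) using 1
    · rfl
    · funext n
      have hg := zpow_ne_zero n hq0
      simp only [Function.comp_apply, Equiv.subRight_apply, Equiv.coe_addRight]
      rw [centralQBinom_succ hq hq0, thetaTerm_sub_one hq0 hw, thetaTerm_add_one hq0 hw]
      field_simp
      ring
    · rw [qpochFin_succ, qpochFin_succ]
      field_simp
      ring

lemma summable_thetaTerm {q w : ℂ} (hq : ‖q‖ < 1) (hq0 : q ≠ 0) (hw : w ≠ 0) :
    Summable (thetaTerm q w) := by
  have hpi : (Real.pi : ℂ) ≠ 0 := by exact_mod_cast Real.pi_ne_zero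
  have hs := (summable_jacobiTheta₂_term_iff (log w / (2 * Real.pi * I))
    (log q / (Real.pi * I))).mpr (by
      have h : log q / (Real.pi * I) = -I * log q / (Real.pi : ℂ) := by
        field_simp
        simp
      rw [h, div_ofReal_im]
      refine div_pos ?_ Real.pi_pos
      simpa [log_re] using Real.log_neg (norm_pos_iff.mpr hq0) hq)
  refine .of_norm (hs.norm.congr fun n ↦ ?_)
  have h : thetaTerm q w n =
      (-1) ^ n * jacobiTheta₂_term n (log w / (2 * Real.pi * I)) (log q / (Real.pi * I)) := by
    rw [thetaTerm, jacobiTheta₂_term, exp_add, mul_assoc]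
    congr 1
    rw [mul_comm]
    congr 1
    · conv_lhs => rw [← exp_log hw]
      rw [← exp_int_mul]
      congr 1
      field_simp
    · conv_lhs => rw [← exp_log hq0]
      rw [← exp_int_mul]
      congr 1
      push_cast
      field_simp
  rw [h, norm_mul, norm_zpow, norm_neg, norm_one, one_zpow, one_mul]

/-- The Jacobi triple product identity. -/
lemma tsum_thetaTerm {q w : ℂ} (hq : ‖q‖ < 1) (hq0 : q ≠ 0) (hw : w ≠ 0) :
    ∑' n, thetaTerm q w n =
      qpoch (q ^ 2) (q ^ 2) * qpoch (q * w) (q ^ 2) * qpoch (q * w⁻¹) (q ^ 2) := by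
  have hQ := norm_sq_lt_one hq
  have hne := qpoch_self_ne_zero_s12 hQ
  obtain ⟨C, hC⟩ := exists_norm_qpochFin_le (q ^ 2) hQ
  obtain ⟨D, hD⟩ := exists_norm_invQpoch_le hQ
  have hC0 : 0 ≤ C := (norm_nonneg _).trans (hC 0)
  have hD0 : 0 ≤ D := (norm_nonneg _).trans (hD 0)
  have hbinom (n : ℤ) :
      Tendsto (fun N ↦ centralQBinom q N n) atTop (𝓝 (qpoch (q ^ 2) (q ^ 2))⁻¹) := by
    have h1 := (tendsto_qpochFin (q ^ 2) hQ).comp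
      (tendsto_id.const_mul_atTop' (two_pos : (0 : ℕ) < 2))
    have h2 := (tendsto_invQpoch hQ).comp
      (tendsto_atTop_add_const_right _ n (tendsto_natCast_atTop_atTop (R := ℤ)))
    have h3 := (tendsto_invQpoch hQ).comp
      (tendsto_atTop_add_const_right _ (-n) (tendsto_natCast_atTop_atTop (R := ℤ)))
    have h := (h1.mul h2).mul h3
    rw [mul_inv_cancel₀ hne, one_mul] at h
    exact h
  have hlim := tendsto_tsum_of_dominated_convergence (𝓕 := atTop)
    (f := fun N n ↦ thetaTerm q w n * centralQBinom q N n)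
    ((summable_thetaTerm hq hq0 hw).norm.mul_right (C * D * D))
    (fun n ↦ (hbinom n).const_mul (thetaTerm q w n))
    (.of_forall fun N n ↦ by
      rw [norm_mul, centralQBinom, norm_mul, norm_mul]
      gcongr
      exacts [hC _, hD _, hD _])
  simp only [(hasSum_thetaTerm_mul_centralQBinom hq hq0 hw _).tsum_eq, tsum_mul_right] at hlim
  have h := tendsto_nhds_unique hlim
    ((tendsto_qpochFin (q * w) hQ).mul (tendsto_qpochFin (q * w⁻¹) hQ))
  rw [mul_assoc, ← h]
  field_simp

theorem theta4_product_formula (τ : ℂ) (hτ : 0 < τ.im) (z : ℂ) :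
    theta4 z τ =
      qpoch (exp ((Real.pi : ℂ) * I * τ) ^ 2) (exp ((Real.pi : ℂ) * I * τ) ^ 2) *
        qpoch (exp ((Real.pi : ℂ) * I * τ) * exp (2 * z * I)) (exp ((Real.pi : ℂ) * I * τ) ^ 2) *
        qpoch (exp ((Real.pi : ℂ) * I * τ) * exp (-(2 * z * I))) (exp ((Real.pi : ℂ) * I * τ) ^ 2) := by
  have hq : ‖exp ((Real.pi : ℂ) * I * τ)‖ < 1 := by
    rw [norm_exp, Real.exp_lt_one_iff]
    simpa using mul_pos Real.pi_pos hτ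
  rw [exp_neg, ← tsum_thetaTerm hq (exp_ne_zero _) (exp_ne_zero _), theta4]
  refine tsum_congr fun k ↦ ?_
  rw [thetaTerm, ← exp_int_mul, ← exp_int_mul]
  push_cast
  congr 2
  · ring_nf
  · ring_nf
end
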